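/- arXiv:2110.07784 — 2 statements merged into one kernel-verified Lean document; each statement's English description precedes it below -/
import Mathlib

section
/- For every n ≥ 1, the number of permutations of [n] avoiding both of the patterns 123 and 312 equals 1 + n(n−1)/2. -/
/-- `σ` contains the pattern `τ`. -/
def ContainsPat {n k : ℕ} (σ : Equiv.Perm (Fin n)) (τ : Equiv.Perm (Fin k)) : Prop :=
  ∃ f : Fin k → Fin n, StrictMono f ∧ ∀ a b : Fin k, σ (f a) < σ (f b) ↔ τ a < τ b

/-- `σ` avoids every pattern in the set `B`. -/
def AvoidsAll {n : ℕ} (B : Set (Σ k, Equiv.Perm (Fin k))) (σ : Equiv.Perm (Fin n)) : Prop :=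
  ∀ p ∈ B, ¬ ContainsPat σ p.2

/-- The pattern 123 (0-based one-line notation). -/
noncomputable def p123 : Equiv.Perm (Fin 3) :=
  Equiv.ofBijective ![0, 1, 2] (by decide)

/-- The pattern 312 (0-based one-line notation). -/
noncomputable def p312 : Equiv.Perm (Fin 3) :=
  Equiv.ofBijective ![2, 0, 1] (by decide)

/-- Order relation attached to parameters `(m, q)`: among `i < j`, ascents are `i < m ≤ j ≤ q`. -/
def RelMQ {n : ℕ} (m q : ℕ) (σ : Equiv.Perm (Fin n)) : Prop :=
  ∀ i j : Fin n, i < j → (σ i < σ j ↔ (i.val < m ∧ m ≤ j.val ∧ j.val ≤ q))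

lemma contains_123_iff {n : ℕ} (σ : Equiv.Perm (Fin n)) :
    ContainsPat σ p123 ↔ ∃ i j k : Fin n, i < j ∧ j < k ∧ σ i < σ j ∧ σ j < σ k := by
  constructor
  · rintro ⟨f, hf, h⟩
    refine ⟨f 0, f 1, f 2, hf (by decide), hf (by decide), (h 0 1).2 ?_, (h 1 2).2 ?_⟩ <;>
      simp [p123]
  · rintro ⟨i, j, k, hij, hjk, h1, h2⟩
    refine ⟨![i, j, k], ?_, ?_⟩
    · intro a b hab
      fin_cases a <;> fin_cases b <;> simp_all
      exact hij.trans hjk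
    · intro a b
      have h3 := h1.trans h2
      fin_cases a <;> fin_cases b <;> simp [p123, h1, h2, h3, h1.le, h2.le, h3.le]

lemma contains_312_iff {n : ℕ} (σ : Equiv.Perm (Fin n)) :
    ContainsPat σ p312 ↔ ∃ i j k : Fin n, i < j ∧ j < k ∧ σ j < σ k ∧ σ k < σ i := by
  constructor
  · rintro ⟨f, hf, h⟩
    refine ⟨f 0, f 1, f 2, hf (by decide), hf (by decide), (h 1 2).2 ?_, (h 2 0).2 ?_⟩ <;>
      simp [p312]
  · rintro ⟨i, j, k, hij, hjk, h1, h2⟩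
    refine ⟨![i, j, k], ?_, ?_⟩
    · intro a b hab
      fin_cases a <;> fin_cases b <;> simp_all
      exact hij.trans hjk
    · intro a b
      have h3 := h1.trans h2
      fin_cases a <;> fin_cases b <;> simp [p312, h1, h2, h3, h1.le, h2.le, h3.le]

lemma avoids_iff {n : ℕ} (σ : Equiv.Perm (Fin n)) :
    AvoidsAll ({⟨3, p123⟩, ⟨3, p312⟩} : Set (Σ k, Equiv.Perm (Fin k))) σ ↔
      (∀ i j k : Fin n, i < j → j < k → σ i < σ j → ¬ σ j < σ k) ∧
      (∀ i j k : Fin n, i < j → j < k → σ j < σ k → ¬ σ k < σ i) := by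
  have : AvoidsAll ({⟨3, p123⟩, ⟨3, p312⟩} : Set (Σ k, Equiv.Perm (Fin k))) σ ↔
      ¬ ContainsPat σ p123 ∧ ¬ ContainsPat σ p312 := by
    unfold AvoidsAll
    constructor
    · intro h
      exact ⟨h ⟨3, p123⟩ (by simp), h ⟨3, p312⟩ (by simp)⟩
    · rintro ⟨h1, h2⟩ p hp
      rcases hp with rfl | hp
      · exact h1
      · rw [Set.mem_singleton_iff] at hp
        subst hp
        exact h2
  rw [this, contains_123_iff, contains_312_iff]
  push Not
  simp only [not_lt]

lemma RelMQ.unique {n m q : ℕ} {σ τ : Equiv.Perm (Fin n)} (hσ : RelMQ m q σ)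
    (hτ : RelMQ m q τ) : σ = τ := by
  have key : ∀ i j, σ i < σ j → τ i < τ j := by
    intro i j h
    rcases lt_trichotomy i j with hij | rfl | hij
    · exact (hτ i j hij).2 ((hσ i j hij).1 h)
    · exact absurd h (lt_irrefl _)
    · have h1 : ¬ τ j < τ i := fun h' => lt_asymm h ((hσ j i hij).2 ((hτ j i hij).1 h'))
      exact lt_of_le_of_ne (not_lt.1 h1) (fun h' => hij.ne' (τ.injective h'))
  have hm : StrictMono (fun x => τ (σ.symm x)) := by
    intro x y hxy
    exact key _ _ (by simpa using hxy)
  have h2 : (fun x => τ (σ.symm x)) = id := by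
    apply (StrictMono.range_inj hm strictMono_id).1
    rw [Set.range_id]
    exact (σ.symm.trans τ).surjective.range_eq
  ext i
  have := congrFun h2 (σ i)
  simp at this
  rw [this]

lemma RelMQ.avoids {n m q : ℕ} {σ : Equiv.Perm (Fin n)} (hσ : RelMQ m q σ) :
    AvoidsAll ({⟨3, p123⟩, ⟨3, p312⟩} : Set (Σ k, Equiv.Perm (Fin k))) σ := by
  rw [avoids_iff]
  constructor
  · intro i j k hij hjk h1 h2
    have a := (hσ i j hij).1 h1
    have b := (hσ j k hjk).1 h2
    omega
  · intro i j k hij hjk h1 h2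
    have b := (hσ j k hjk).1 h1
    have hik := hij.trans hjk
    have c : σ i < σ k := (hσ i k hik).2 ⟨by have : i.val < j.val := hij; omega, b.2⟩
    exact lt_asymm c h2

lemma exists_rel {n : ℕ} (hn : 1 ≤ n) (σ : Equiv.Perm (Fin n))
    (h : AvoidsAll ({⟨3, p123⟩, ⟨3, p312⟩} : Set (Σ k, Equiv.Perm (Fin k))) σ) :
    ∃ m q : ℕ, m ≤ q ∧ q < n ∧ (m = 0 → q = 0) ∧ RelMQ m q σ := by
  rw [avoids_iff] at h
  obtain ⟨h1, h2⟩ := h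
  haveI : NeZero n := ⟨by omega⟩
  obtain ⟨m, hm⟩ : ∃ m, ∀ i, σ i ≤ σ m := Finite.exists_max σ
  obtain ⟨q, hq0, hq⟩ : ∃ q, σ 0 ≤ σ q ∧ ∀ j, σ 0 ≤ σ j → j ≤ q := by
    obtain ⟨q, hq, hq'⟩ := Finset.exists_max_image
      (Finset.univ.filter (fun j : Fin n => σ 0 ≤ σ j)) id ⟨0, by simp⟩
    exact ⟨q, by simpa using hq, fun j hj => hq' j (by simpa using hj)⟩
  have hmlt : ∀ i, i ≠ m → σ i < σ m := fun i hi =>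
    lt_of_le_of_ne (hm i) (fun h => hi (σ.injective h))
  have h0lt : ∀ i, i ≠ 0 → σ 0 ≤ σ i → σ 0 < σ i := fun i hi h =>
    lt_of_le_of_ne h (fun h => hi (σ.injective h).symm)
  have hpos : ∀ i : Fin n, i ≠ 0 → 0 < i := fun i hi => Fin.pos_iff_ne_zero.2 hi
  refine ⟨m, q, hq m (hm 0), q.2, ?_, ?_⟩
  · intro hm0
    have hm0 : m = 0 := Fin.ext (by simpa using hm0)
    subst hm0
    have : q = 0 := σ.injective (le_antisymm (hm q) hq0)
    simp [this]
  · intro i j hij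
    change σ i < σ j ↔ (i < m ∧ m ≤ j ∧ j ≤ q)
    constructor
    · intro hs
      have him : i < m := by
        by_contra hc
        rcases (not_lt.1 hc).eq_or_lt with rfl | hc
        · exact absurd hs (not_lt.2 (hm j))
        · by_cases hj : j = m
          · subst hj; exact lt_asymm hij hc
          · exact h2 m i j hc hij hs (hmlt j hj)
      refine ⟨him, ?_, ?_⟩
      · by_contra hc
        have hc := not_le.1 hc
        exact h1 i j m hij hc hs (hmlt j hc.ne)
      · apply hq
        by_cases hi : i = 0
        · subst hi; exact hs.le
        · exact not_lt.1 (h2 0 i j (hpos i hi) hij hs)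
    · rintro ⟨him, hmj, hjq⟩
      rcases hmj.eq_or_lt with rfl | hmj
      · exact hmlt i him.ne
      · have hj0 : j ≠ 0 := ((Fin.zero_le i).trans_lt hij).ne'
        have hj : σ 0 < σ j := by
          by_contra hc
          have hc : σ j < σ 0 := lt_of_le_of_ne (not_lt.1 hc) (fun h => hj0 (σ.injective h))
          have hjq' : j < q := lt_of_le_of_ne hjq (by rintro rfl; exact absurd hc (not_lt.2 hq0))
          exact h2 m j q hmj hjq' (hc.trans_le hq0) (hmlt q (hmj.trans hjq').ne')
        by_contra hc
        have hc := not_lt.1 hc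
        have hi0 : i ≠ 0 := by rintro rfl; exact absurd hj (not_lt.2 hc)
        exact h1 0 i m (hpos i hi0) him (hj.trans_le hc) (hmlt i him.ne)

lemma exists_perm {n m q : ℕ} (hmq : m ≤ q) (hq : q < n) :
    ∃ σ : Equiv.Perm (Fin n), RelMQ m q σ := by
  let v : ℕ → ℕ := fun i =>
    if i < m then n + m - 2 - q - i else if i ≤ q then n + m - 1 - i else n - 1 - i
  have hv : ∀ i, i < n → v i < n := by
    intro i hi
    simp only [v]
    split_ifs <;> omega
  let f : Fin n → Fin n := fun i => ⟨v i, hv i i.2⟩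
  have hf : Function.Injective f := by
    intro i j hij
    have h : v i = v j := congrArg Fin.val hij
    have hi := i.2
    have hj := j.2
    apply Fin.ext
    simp only [v] at h
    split_ifs at h <;> omega
  refine ⟨Equiv.ofBijective f (Finite.injective_iff_bijective.1 hf), ?_⟩
  intro i j hij
  change v i < v j ↔ _
  have hij : i.val < j.val := hij
  have hi := i.2
  have hj := j.2
  simp only [v]
  split_ifs <;> omega

/-- First parameter. -/
def parM {n : ℕ} : Option (Σ q : Fin n, Fin q.val) → ℕ
  | none => 0
  | some x => x.2.val + 1

/-- Second parameter. -/
def parQ {n : ℕ} : Option (Σ q : Fin n, Fin q.val) → ℕ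
  | none => 0
  | some x => x.1.val

lemma par_le {n : ℕ} (x : Option (Σ q : Fin n, Fin q.val)) : parM x ≤ parQ x := by
  rcases x with _ | ⟨q, m⟩
  · simp [parM, parQ]
  · exact m.2

lemma par_lt {n : ℕ} (hn : 1 ≤ n) (x : Option (Σ q : Fin n, Fin q.val)) : parQ x < n := by
  rcases x with _ | ⟨q, m⟩
  · exact hn
  · exact q.2

lemma par_zero {n : ℕ} (x : Option (Σ q : Fin n, Fin q.val)) (h : parM x = 0) :
    parQ x = 0 := by
  rcases x with _ | ⟨q, m⟩
  · rfl
  · simp [parM] at h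

lemma par_inj {n : ℕ} (x y : Option (Σ q : Fin n, Fin q.val)) (h : parM x = parM y)
    (h' : parQ x = parQ y) : x = y := by
  rcases x with _ | ⟨⟨q, hq⟩, ⟨m, hm⟩⟩ <;> rcases y with _ | ⟨⟨q', hq'⟩, ⟨m', hm'⟩⟩
  · rfl
  · simp [parM] at h
  · simp [parM] at h
  · simp [parM, parQ] at h h'
    subst h h'
    rfl

lemma par_surj {n m q : ℕ} (hmq : m ≤ q) (hq : q < n) (h0 : m = 0 → q = 0) :
    ∃ x : Option (Σ q : Fin n, Fin q.val), parM x = m ∧ parQ x = q := by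
  rcases m with _ | m
  · exact ⟨none, rfl, (h0 rfl).symm⟩
  · exact ⟨some ⟨⟨q, hq⟩, ⟨m, hmq⟩⟩, rfl, rfl⟩

lemma rel_params {n m q m' q' : ℕ} {σ : Equiv.Perm (Fin n)} (h : RelMQ m q σ)
    (h' : RelMQ m' q' σ) (a : m ≤ q) (b : q < n) (c : m = 0 → q = 0)
    (a' : m' ≤ q') (b' : q' < n) (c' : m' = 0 → q' = 0) : m = m' ∧ q = q' := by
  have e : ∀ i j : ℕ, i < j → j < n → ((i < m ∧ m ≤ j ∧ j ≤ q) ↔ (i < m' ∧ m' ≤ j ∧ j ≤ q')) := by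
    intro i j hij hj
    exact (h ⟨i, hij.trans hj⟩ ⟨j, hj⟩ hij).symm.trans (h' ⟨i, hij.trans hj⟩ ⟨j, hj⟩ hij)
  by_cases hm : m = 0
  · by_cases hm' : m' = 0
    · omega
    · have := e 0 m' (by omega) (by omega)
      omega
  · have e1 := e (m - 1) m (by omega) (by omega)
    have e2 := e 0 q (by omega) (by omega)
    have e3 := e (m' - 1) m'
    have e4 := e 0 q'
    omega

theorem card_avoiders_123_312 (n : ℕ) (hn : 1 ≤ n) :
    Nat.card {σ : Equiv.Perm (Fin n) //
        AvoidsAll ({⟨3, p123⟩, ⟨3, p312⟩} : Set (Σ k, Equiv.Perm (Fin k))) σ} =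
      1 + n * (n - 1) / 2 := by
  choose F hF using fun x : Option (Σ q : Fin n, Fin q.val) =>
    exists_perm (par_le x) (par_lt hn x)
  let G : Option (Σ q : Fin n, Fin q.val) → {σ : Equiv.Perm (Fin n) //
        AvoidsAll ({⟨3, p123⟩, ⟨3, p312⟩} : Set (Σ k, Equiv.Perm (Fin k))) σ} :=
    fun x => ⟨F x, (hF x).avoids⟩
  have hG : Function.Bijective G := by
    constructor
    · intro x y hxy
      have hxy : F x = F y := congrArg Subtype.val hxy
      have hy := hF y
      rw [← hxy] at hy
      obtain ⟨h1, h2⟩ := rel_params (hF x) hy (par_le x) (par_lt hn x) (par_zero x)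
        (par_le y) (par_lt hn y) (par_zero y)
      exact par_inj x y h1 h2
    · rintro ⟨σ, hσ⟩
      obtain ⟨m, q, h1, h2, h3, h4⟩ := exists_rel hn σ hσ
      obtain ⟨x, rfl, rfl⟩ := par_surj h1 h2 h3
      exact ⟨x, Subtype.ext ((hF x).unique h4)⟩
  rw [← Nat.card_congr (Equiv.ofBijective G hG), Nat.card_eq_fintype_card, Fintype.card_option,
    Fintype.card_sigma]
  simp only [Fintype.card_fin]
  rw [Fin.sum_univ_eq_sum_range (fun i => i) n, Finset.sum_range_id, add_comm]
end

section
/- Let B = {123, 312, 21543}. Then |S_1(B)| = 1, |S_2(B)| = 2, and |S_n(B)| = 3n − 5 for all n ≥ 3. (Equivalently, the generating function Σ_{n≥1} |S_n(B)| x^n equals (x + x³ + x⁴)/(1−x)².) -/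
/-- The pattern 21543 (0-based one-line notation). -/
noncomputable def p21543 : Equiv.Perm (Fin 5) :=
  Equiv.ofBijective ![1, 0, 4, 3, 2] (by decide)

noncomputable def a15 (n : ℕ) : ℕ :=
  Nat.card {σ : Equiv.Perm (Fin n) //
    AvoidsAll ({⟨3, p123⟩, ⟨3, p312⟩, ⟨5, p21543⟩} : Set (Σ k, Equiv.Perm (Fin k))) σ}

/-- `σ` has ascending pairs exactly prescribed by the parameters `(a, b)`. -/
def HasType {n : ℕ} (a b : ℕ) (σ : Equiv.Perm (Fin n)) : Prop :=
  ∀ x y : Fin n, x < y → (σ x < σ y ↔ (x.val < a ∧ a ≤ y.val ∧ y.val < a + b))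

def Good (n a b : ℕ) : Prop :=
  (a = 0 ∧ b = 0) ∨ (1 ≤ a ∧ 1 ≤ b ∧ a + b ≤ n ∧ (a = 1 ∨ b ≤ 2))

def Av {n : ℕ} (σ : Equiv.Perm (Fin n)) : Prop :=
  AvoidsAll ({⟨3, p123⟩, ⟨3, p312⟩, ⟨5, p21543⟩} : Set (Σ k, Equiv.Perm (Fin k))) σ

theorem av_iff {n : ℕ} (σ : Equiv.Perm (Fin n)) :
    Av σ ↔ ¬ ContainsPat σ p123 ∧ ¬ ContainsPat σ p312 ∧ ¬ ContainsPat σ p21543 := by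
  simp [Av, AvoidsAll]

theorem contains123 {n : ℕ} (σ : Equiv.Perm (Fin n)) :
    ContainsPat σ p123 ↔ ∃ x y z : Fin n, x < y ∧ y < z ∧ σ x < σ y ∧ σ y < σ z := by
  constructor
  · rintro ⟨f, hf, h⟩
    exact ⟨f 0, f 1, f 2, hf (by decide), hf (by decide),
      (h 0 1).2 (by simp [p123]), (h 1 2).2 (by simp [p123])⟩
  · rintro ⟨x, y, z, h1, h2, h3, h4⟩
    refine ⟨![x, y, z], ?_, ?_⟩
    · rw [Fin.strictMono_iff_lt_succ]
      intro i
      fin_cases i <;> simpa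
    · intro i j
      fin_cases i <;> fin_cases j <;> simp [p123] <;> order

theorem contains312 {n : ℕ} (σ : Equiv.Perm (Fin n)) :
    ContainsPat σ p312 ↔ ∃ x y z : Fin n, x < y ∧ y < z ∧ σ y < σ z ∧ σ z < σ x := by
  constructor
  · rintro ⟨f, hf, h⟩
    exact ⟨f 0, f 1, f 2, hf (by decide), hf (by decide),
      (h 1 2).2 (by simp [p312]), (h 2 0).2 (by simp [p312])⟩
  · rintro ⟨x, y, z, h1, h2, h3, h4⟩
    refine ⟨![x, y, z], ?_, ?_⟩
    · rw [Fin.strictMono_iff_lt_succ]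
      intro i
      fin_cases i <;> simpa
    · intro i j
      fin_cases i <;> fin_cases j <;> simp [p312] <;> order

theorem contains21543 {n : ℕ} (σ : Equiv.Perm (Fin n)) :
    ContainsPat σ p21543 ↔ ∃ x y z u v : Fin n, x < y ∧ y < z ∧ z < u ∧ u < v ∧
      σ y < σ x ∧ σ x < σ v ∧ σ v < σ u ∧ σ u < σ z := by
  constructor
  · rintro ⟨f, hf, h⟩
    exact ⟨f 0, f 1, f 2, f 3, f 4, hf (by decide), hf (by decide), hf (by decide), hf (by decide),
      (h 1 0).2 (by simp [p21543]), (h 0 4).2 (by simp [p21543]),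
      (h 4 3).2 (by simp [p21543]), (h 3 2).2 (by simp [p21543])⟩
  · rintro ⟨x, y, z, u, v, h1, h2, h3, h4, h5, h6, h7, h8⟩
    refine ⟨![x, y, z, u, v], ?_, ?_⟩
    · rw [Fin.strictMono_iff_lt_succ]
      intro i
      fin_cases i <;> simpa
    · intro i j
      have e : ∀ i, p21543 i = ![1, 0, 4, 3, 2] i := fun i => rfl
      rw [e, e]
      fin_cases i <;> fin_cases j <;> simp [-Fin.val_fin_lt] <;>
        first | order | (rw [iff_true_right (by decide)]; order) |
          (rw [iff_false_right (by decide)]; order)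

theorem type_av {n a b : ℕ} (σ : Equiv.Perm (Fin n)) (hg : Good n a b) (h : HasType a b σ) :
    Av σ := by
  rw [av_iff, contains123, contains312, contains21543]
  refine ⟨?_, ?_, ?_⟩
  · rintro ⟨x, y, z, h1, h2, h3, h4⟩
    have := (h x y h1).1 h3
    have := (h y z h2).1 h4
    omega
  · rintro ⟨x, y, z, h1, h2, h3, h4⟩
    have := (h y z h2).1 h3
    have h5 := (h x z (h1.trans h2)).2 (by rw [Fin.lt_def] at h1; omega)
    order
  · rintro ⟨x, y, z, u, v, h1, h2, h3, h4, h5, h6, h7, h8⟩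
    have a1 := (h x z (by order)).1 (by order)
    have a2 := (h x v (by order)).1 (by order)
    have a3 := (h y z (by order)).1 (by order)
    rw [Fin.lt_def] at h1 h2 h3 h4
    unfold Good at hg
    omega

theorem type_unique {n a b : ℕ} (σ τ : Equiv.Perm (Fin n)) (h : HasType a b σ)
    (h' : HasType a b τ) : σ = τ := by
  have key : ∀ x y, σ x < σ y → τ x < τ y := by
    intro x y hxy
    rcases lt_trichotomy x y with l | l | l
    · exact (h' x y l).2 ((h x y l).1 hxy)
    · subst l; exact absurd hxy (lt_irrefl _)
    · by_contra hc
      have hne : τ x ≠ τ y := fun e => l.ne' (τ.injective e)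
      have := (h y x l).2 ((h' y x l).1 (by order))
      order
  have hm : StrictMono (fun i => τ (σ.symm i)) := by
    intro i j hij
    apply key
    simpa using hij
  have hid : (fun i => τ (σ.symm i)) = id :=
    hm.range_inj strictMono_id |>.1 (by
      rw [Set.range_id]
      exact (σ.symm.trans τ).surjective.range_eq)
  ext x
  have := congrFun hid (σ x)
  simp at this
  rw [this]

theorem type_params {n a b a' b' : ℕ} (σ : Equiv.Perm (Fin n)) (hg : Good n a b)
    (hg' : Good n a' b') (h : HasType a b σ) (h' : HasType a' b' σ) : a = a' ∧ b = b' := by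
  have key : ∀ x y : ℕ, x < y → y < n →
      ((x < a ∧ a ≤ y ∧ y < a + b) ↔ (x < a' ∧ a' ≤ y ∧ y < a' + b')) := by
    intro x y hxy hy
    have h1 := h ⟨x, by omega⟩ ⟨y, hy⟩ hxy
    have h2 := h' ⟨x, by omega⟩ ⟨y, hy⟩ hxy
    exact h1.symm.trans h2
  have k1 := key (a - 1) a
  have k2 := key (a - 1) (a + b - 1)
  have k3 := key (a' - 1) a'
  have k4 := key (a' - 1) (a' + b' - 1)
  rcases hg with ⟨g1, g2⟩ | ⟨g1, g2, g3, -⟩ <;> rcases hg' with ⟨g1', g2'⟩ | ⟨g1', g2', g3', -⟩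
  · omega
  · have := (k3 (by omega) (by omega)).2 (by omega)
    omega
  · have := (k1 (by omega) (by omega)).1 (by omega)
    omega
  · have e1 := (k1 (by omega) (by omega)).1 (by omega)
    have e2 := (k2 (by omega) (by omega)).1 (by omega)
    have e3 := (k3 (by omega) (by omega)).2 (by omega)
    have e4 := (k4 (by omega) (by omega)).2 (by omega)
    omega

theorem type_exists {n a b : ℕ} (hg : Good n a b) :
    ∃ σ : Equiv.Perm (Fin n), HasType a b σ := by
  have hab : a + b ≤ n := by unfold Good at hg; omega
  let g : Fin n → Fin n := fun j =>
    if j.val < a then ⟨n - b - 1 - j.val, by omega⟩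
    else if j.val < a + b then ⟨n - 1 - (j.val - a), by omega⟩
    else ⟨n - 1 - j.val, by omega⟩
  have hval : ∀ j, (g j).val = if j.val < a then n - b - 1 - j.val
    else if j.val < a + b then n - 1 - (j.val - a) else n - 1 - j.val := by
    intro j; simp only [g]; split_ifs <;> rfl
  have hinj : Function.Injective g := by
    intro x y hxy
    have := congrArg Fin.val hxy
    rw [hval, hval] at this
    have := x.2
    have := y.2
    apply Fin.ext
    split_ifs at * <;> omega
  refine ⟨Equiv.ofBijective g (Finite.injective_iff_bijective.1 hinj), ?_⟩
  intro x y hxy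
  simp only [Equiv.ofBijective_apply]
  rw [Fin.lt_def] at hxy
  rw [Fin.lt_def, hval, hval]
  have := x.2
  have := y.2
  split_ifs <;> omega

theorem av_type {n : ℕ} (σ : Equiv.Perm (Fin n)) (hn : 1 ≤ n) (h : Av σ) :
    ∃ a b, Good n a b ∧ HasType a b σ := by
  rw [av_iff, contains123, contains312, contains21543] at h
  obtain ⟨h1, h2, h3⟩ := h
  push Not at h1 h2 h3
  have hinj : ∀ x y, x < y → σ x ≠ σ y := fun x y l e => l.ne (σ.injective e)
  obtain ⟨m, hm⟩ := σ.surjective ⟨n - 1, by omega⟩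
  have hmax : ∀ x, σ x ≤ σ m := by
    intro x; rw [hm, Fin.le_def]; have := (σ x).2; simp only; omega
  have hpre : ∀ x y, x < y → y < m → σ y < σ x := by
    intro x y hxy hy
    by_contra hc
    have := h1 x y m hxy hy (by have := hinj x y hxy; order)
    have := hmax y
    have := hinj y m hy
    order
  have hpost : ∀ x y, x < y → m ≤ x → σ y < σ x := by
    intro x y hxy hy
    have n1 := hinj x y hxy
    have n2 := hinj m y (by order)
    have n3 := hmax y
    rcases hy.eq_or_lt with e | l
    · subst e; order
    · by_contra hc
      have := h2 m x y l hxy (by order)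
      order
  have hcross : ∀ x x' y, x < m → x' < m → m ≤ y → σ x < σ y → σ x' < σ y := by
    intro x x' y hx hx' hy hxy
    by_contra hc
    have n1 := hinj x' y (by order)
    rcases lt_trichotomy x x' with l | l | l
    · have := hpre x x' l hx'; order
    · subst l; order
    · have := h2 x' x y l (by order) hxy; order
  by_cases hm0 : m.val = 0
  · refine ⟨0, 0, Or.inl ⟨rfl, rfl⟩, ?_⟩
    intro x y hxy
    have := hpost x y hxy (by rw [Fin.le_def]; omega)
    constructor
    · intro; order
    · omega
  · let z : Fin n := ⟨0, by omega⟩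
    have hz : z < m := by rw [Fin.lt_def]; show 0 < m.val; omega
    have hex : ∃ t, m.val ≤ t ∧ ∀ ht : t < n, σ ⟨t, ht⟩ < σ z :=
      ⟨n, m.2.le, fun ht => absurd ht (lt_irrefl _)⟩
    classical
    obtain ⟨t, ⟨ht1, ht2⟩, ht3⟩ : ∃ t, (m.val ≤ t ∧ ∀ ht : t < n, σ ⟨t, ht⟩ < σ z) ∧
        ∀ s, s < t → ¬ (m.val ≤ s ∧ ∀ hs : s < n, σ ⟨s, hs⟩ < σ z) :=
      ⟨Nat.find hex, Nat.find_spec hex, fun s hs => Nat.find_min hex hs⟩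
    have htn : t ≤ n := by
      by_contra hc
      exact ht3 n (by omega) ⟨m.2.le, fun ht => absurd ht (lt_irrefl _)⟩
    have hz' : ∀ y, m ≤ y → (σ z < σ y ↔ y.val < t) := by
      intro y hy
      constructor
      · intro hl
        by_contra hc
        have htn' : t < n := by omega
        have q := ht2 htn'
        rcases (show t ≤ y.val by omega).eq_or_lt with e | l
        · have : (⟨t, htn'⟩ : Fin n) = y := Fin.ext e
          rw [this] at q; order
        · have := hpost ⟨t, htn'⟩ y l ht1
          order
      · intro hl
        by_contra hc
        refine ht3 y hl ⟨hy, fun hs => ?_⟩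
        have := hinj z y (by order)
        show σ y < σ z
        order
    have htm : m.val < t := by
      rw [← hz' m le_rfl]
      have := hmax z
      have := hinj z m hz
      order
    have hT : HasType m.val (t - m.val) σ := by
      intro x y hxy
      by_cases hx : x < m
      · by_cases hy : y < m
        · have := hpre x y hxy hy
          rw [Fin.lt_def] at hy
          constructor
          · intro; order
          · omega
        · have hy' : m ≤ y := by order
          have e : σ x < σ y ↔ σ z < σ y :=
            ⟨hcross x z y hx hz hy', hcross z x y hz hx hy'⟩
          rw [e, hz' y hy']
          rw [Fin.lt_def] at hx
          rw [Fin.le_def] at hy'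
          omega
      · have := hpost x y hxy (by order)
        rw [Fin.lt_def] at hx
        constructor
        · intro; order
        · omega
    refine ⟨m.val, t - m.val, Or.inr ⟨by omega, by omega, by omega, ?_⟩, hT⟩
    by_contra hc
    have hm2 : 2 ≤ m.val := by omega
    have q1 : (⟨1, by omega⟩ : Fin n) < m := by rw [Fin.lt_def]; simp only; omega
    have l01 : z < ⟨1, by omega⟩ := by rw [Fin.lt_def]; show 0 < 1; omega
    have l1 : m < ⟨m.val + 1, by omega⟩ := by rw [Fin.lt_def]; simp only; omega
    have l2 : (⟨m.val + 1, by omega⟩ : Fin n) < ⟨m.val + 2, by omega⟩ := by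
      rw [Fin.lt_def]; simp only; omega
    have r1 := hpost _ _ l1 le_rfl
    have r2 := hpost _ _ l2 l1.le
    have r3 := h3 z ⟨1, by omega⟩ m _ _ l01 q1 l1 l2 (hpre _ _ l01 q1)
      ((hz' _ (by order)).2 (by simp only; omega)) r2
    order

def params (n : ℕ) : Finset (ℕ × ℕ) :=
  insert (0, 0) ((Finset.range (n - 1)).image (fun b => (1, b + 1)) ∪
    ((Finset.range (n - 2)).image (fun a => (a + 2, 1)) ∪
     (Finset.range (n - 3)).image (fun a => (a + 2, 2))))

theorem mem_params {n a b : ℕ} : (a, b) ∈ params n ↔ Good n a b := by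
  simp only [params, Finset.mem_insert, Finset.mem_union, Finset.mem_image, Finset.mem_range,
    Prod.mk.injEq, Good]
  constructor
  · rintro (h | ⟨c, h⟩ | ⟨c, h⟩ | ⟨c, h⟩) <;> omega
  · rintro (h | h)
    · exact Or.inl h
    · by_cases ha : a = 1
      · exact Or.inr (Or.inl ⟨b - 1, by omega⟩)
      · by_cases hb : b = 1
        · exact Or.inr (Or.inr (Or.inl ⟨a - 2, by omega⟩))
        · exact Or.inr (Or.inr (Or.inr ⟨a - 2, by omega⟩))

theorem card_params (n : ℕ) : (params n).card = 1 + ((n - 1) + ((n - 2) + (n - 3))) := by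
  unfold params
  rw [Finset.card_insert_of_notMem, Finset.card_union_of_disjoint, Finset.card_union_of_disjoint,
    Finset.card_image_of_injective, Finset.card_image_of_injective,
    Finset.card_image_of_injective]
  · simp only [Finset.card_range]; omega
  · intro x y h; simpa using h
  · intro x y h; simpa using h
  · intro x y h; simpa using h
  · simp [Finset.disjoint_left]
  · simp [Finset.disjoint_left]
  · simp

theorem a15_eq (n : ℕ) (hn : 1 ≤ n) : a15 n = 1 + ((n - 1) + ((n - 2) + (n - 3))) := by
  rw [← card_params, ← Nat.card_eq_finsetCard]
  have hex : ∀ p : params n, ∃ σ : Equiv.Perm (Fin n), HasType p.1.1 p.1.2 σ :=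
    fun p => type_exists (mem_params.1 p.2)
  choose F hF using hex
  symm
  refine Nat.card_eq_of_bijective
    (fun p : params n => ⟨F p, type_av (F p) (mem_params.1 p.2) (hF p)⟩) ⟨?_, ?_⟩
  · intro p q hpq
    have e : F p = F q := congrArg Subtype.val hpq
    have hp := hF p
    rw [e] at hp
    have := type_params (F q) (mem_params.1 p.2) (mem_params.1 q.2) hp (hF q)
    exact Subtype.ext (Prod.ext this.1 this.2)
  · rintro ⟨σ, hσ⟩
    obtain ⟨a, b, hg, ht⟩ := av_type σ hn hσ
    exact ⟨⟨(a, b), mem_params.2 hg⟩, Subtype.ext (type_unique _ _ (hF _) ht)⟩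

theorem card_avoiders_123_312_21543 :
    a15 1 = 1 ∧ a15 2 = 2 ∧ ∀ n : ℕ, 3 ≤ n → a15 n = 3 * n - 5 := by
  refine ⟨by rw [a15_eq 1 le_rfl], by rw [a15_eq 2 (by omega)], fun n hn => ?_⟩
  rw [a15_eq n (by omega)]
  omega
end
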